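/- For all integers k ≥ 1, t ≥ 2 with k + t ≥ 4 and c ∈ {0,1}, the set 𝓑 = 𝓑₁₁ ∪ 𝓑₁₂ ∪ 𝓑₂₁ ∪ 𝓑₂₂ is an F-basis of B^{k,t}_c; in particular dim_F B^{k,t}_c = 9k + t. Moreover, in B^{k,t}_c one has (αβγ)^k = (βγα)^k = βηγ, η^{t−1} = γβ and η^t = (γαβ)^k = ηγβ. -/

import Mathlib

/- Common setup: the algebras B^{k,t}_c = SD(2B)₂^{k,t}(c) of semidihedral type,
   over a field F, presented as a quotient of the free algebra on the paths-generators
   e₁, e₂ (trivial paths), α (loop at vertex 1), β (arrow 1 → 2),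
   γ (arrow 2 → 1), η (loop at vertex 2), by the path-algebra relations
   together with Erdmann's relations  βη = (αβγ)^{k-1}αβ, γβ = η^{t-1},
   ηγ = (γαβ)^{k-1}γα, βη² = 0, η²γ = 0, α² = c(αβγ)^k. -/

noncomputable section

namespace SD2Paper

inductive Gen : Type
  | e1 | e2 | a | b | g | h

variable (F : Type) [Field F]

/-- The generators inside the free algebra. -/
def gen (t : Gen) : FreeAlgebra F Gen := FreeAlgebra.ι F t

/-- The defining relations of `D(2B)^{k,s}(c)` (paths written from left to right). -/
inductive Rel (k t : ℕ) (c : F) : FreeAlgebra F Gen → FreeAlgebra F Gen → Prop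
  | unit : Rel k t c (gen F .e1 + gen F .e2) 1
  | idem1 : Rel k t c (gen F .e1 * gen F .e1) (gen F .e1)
  | idem2 : Rel k t c (gen F .e2 * gen F .e2) (gen F .e2)
  | orth12 : Rel k t c (gen F .e1 * gen F .e2) 0
  | orth21 : Rel k t c (gen F .e2 * gen F .e1) 0
  | aL : Rel k t c (gen F .e1 * gen F .a) (gen F .a)
  | aR : Rel k t c (gen F .a * gen F .e1) (gen F .a)
  | bL : Rel k t c (gen F .e1 * gen F .b) (gen F .b)
  | bR : Rel k t c (gen F .b * gen F .e2) (gen F .b)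
  | gL : Rel k t c (gen F .e2 * gen F .g) (gen F .g)
  | gR : Rel k t c (gen F .g * gen F .e1) (gen F .g)
  | hL : Rel k t c (gen F .e2 * gen F .h) (gen F .h)
  | hR : Rel k t c (gen F .h * gen F .e2) (gen F .h)
  | bh : Rel k t c (gen F .b * gen F .h)
      ((gen F .a * gen F .b * gen F .g) ^ (k - 1) * (gen F .a * gen F .b))
  | gb : Rel k t c (gen F .g * gen F .b) ((gen F .h) ^ (t - 1))
  | hg : Rel k t c (gen F .h * gen F .g)
      ((gen F .g * gen F .a * gen F .b) ^ (k - 1) * (gen F .g * gen F .a))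
  | bh2 : Rel k t c (gen F .b * gen F .h * gen F .h) 0
  | h2g : Rel k t c (gen F .h * gen F .h * gen F .g) 0
  | asq : Rel k t c (gen F .a * gen F .a) (c • (gen F .a * gen F .b * gen F .g) ^ k)

/-- The algebra `B^{k,t}_c = SD(2B)₂^{k,t}(c)`. -/
def BA (k t : ℕ) (c : F) : Type := RingQuot (Rel F k t c)

instance (k t : ℕ) (c : F) : Ring (BA F k t c) :=
  inferInstanceAs (Ring (RingQuot (Rel F k t c)))

instance (k t : ℕ) (c : F) : Algebra F (BA F k t c) :=
  inferInstanceAs (Algebra F (RingQuot (Rel F k t c)))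

variable (k t : ℕ) (c : F)

/-- The canonical projection. -/
def mk : FreeAlgebra F Gen →ₐ[F] BA F k t c := RingQuot.mkAlgHom F (Rel F k t c)

def E1 : BA F k t c := mk F k t c (gen F .e1)
def E2 : BA F k t c := mk F k t c (gen F .e2)
/-- The image of the loop α at vertex 1. -/
def Al : BA F k t c := mk F k t c (gen F .a)
/-- The image of the arrow β : 1 → 2. -/
def Be : BA F k t c := mk F k t c (gen F .b)
/-- The image of the arrow γ : 2 → 1. -/
def Ga : BA F k t c := mk F k t c (gen F .g)
/-- The image of the loop η at vertex 2. -/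
def Et : BA F k t c := mk F k t c (gen F .h)

/-- The path αβγ. -/
def ABG : BA F k t c := Al F k t c * Be F k t c * Ga F k t c
/-- The path βγα. -/
def BGA : BA F k t c := Be F k t c * Ga F k t c * Al F k t c
/-- The path γαβ. -/
def GAB : BA F k t c := Ga F k t c * Al F k t c * Be F k t c

/-- The standard basis paths 𝓑₁₁ of e₁Ae₁. -/
def B11 : Set (BA F k t c) :=
  {E1 F k t c, Al F k t c, Be F k t c * Ga F k t c, (ABG F k t c) ^ k}
    ∪ (fun i => (ABG F k t c) ^ i) '' Set.Icc 1 (k - 1)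
    ∪ (fun i => (ABG F k t c) ^ i * Al F k t c) '' Set.Icc 1 (k - 1)
    ∪ (fun i => (BGA F k t c) ^ i) '' Set.Icc 1 (k - 1)
    ∪ (fun i => (BGA F k t c) ^ i * (Be F k t c * Ga F k t c)) '' Set.Icc 1 (k - 1)

/-- The standard basis paths 𝓑₁₂ of e₁Ae₂. -/
def B12 : Set (BA F k t c) :=
  {Be F k t c, Al F k t c * Be F k t c}
    ∪ (fun i => (BGA F k t c) ^ i * Be F k t c) '' Set.Icc 1 (k - 1)
    ∪ (fun i => (ABG F k t c) ^ i * (Al F k t c * Be F k t c)) '' Set.Icc 1 (k - 1)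

/-- The standard basis paths 𝓑₂₁ of e₂Ae₁. -/
def B21 : Set (BA F k t c) :=
  {Ga F k t c, Ga F k t c * Al F k t c}
    ∪ (fun i => (GAB F k t c) ^ i * Ga F k t c) '' Set.Icc 1 (k - 1)
    ∪ (fun i => (GAB F k t c) ^ i * (Ga F k t c * Al F k t c)) '' Set.Icc 1 (k - 1)

/-- The standard basis paths 𝓑₂₂ of e₂Ae₂. -/
def B22 : Set (BA F k t c) :=
  {E2 F k t c}
    ∪ (fun i => (GAB F k t c) ^ i) '' Set.Icc 1 (k - 1)
    ∪ (fun j => (Et F k t c) ^ j) '' Set.Icc 1 t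

/-- The standard path basis 𝓑 of `A^{k,s}_c`. -/
def BB : Set (BA F k t c) :=
  B11 F k t c ∪ B12 F k t c ∪ B21 F k t c ∪ B22 F k t c

/-- The commutator subspace K(A): the F-linear span of all commutators. -/
def Kspan (A : Type) [Ring A] [Algebra F A] : Submodule F A :=
  Submodule.span F {z : A | ∃ u v : A, z = u * v - v * u}

/-- The (left) socle of a ring: the sum of all simple (left) submodules. -/
def socle (A : Type) [Ring A] : Submodule A A := sSup {S : Submodule A A | IsAtom S}

/-- `ψ` is the linear form sending each standard basis path lying in the socle to 1
    and every other standard basis path to 0. -/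
def SoclePsi (ψ : BA F k t c →ₗ[F] F) : Prop :=
  ∀ p ∈ BB F k t c,
    (p ∈ socle (BA F k t c) → ψ p = 1) ∧ (p ∉ socle (BA F k t c) → ψ p = 0)

/-- `T₁(A) = {x : x² ∈ K(A)}`. -/
def T1set : Set (BA F k t c) := {z | z ^ 2 ∈ Kspan F (BA F k t c)}

/-- The orthogonal space `T₁(A)^⊥` with respect to the form `⟨x, y⟩ = ψ(xy)`. -/
def T1perp (ψ : BA F k t c →ₗ[F] F) : Set (BA F k t c) :=
  {y | ∀ x ∈ T1set F k t c, ψ (y * x) = 0}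

/-- The first generalized Reynolds ideal, as an ideal of the center `Z(A)`. -/
def ReynoldsIdeal (ψ : BA F k t c →ₗ[F] F) :
    Ideal (Subalgebra.center F (BA F k t c)) :=
  Ideal.span {z : Subalgebra.center F (BA F k t c) | (z : BA F k t c) ∈ T1perp F k t c ψ}

section Relations

variable {F} {R : Type} [Ring R] [Algebra F R]

/-- A family of elements of an algebra indexed by the generators and satisfying the
defining relations of `BA`. -/
structure Rels (k t : ℕ) (c : F) (x : Gen → R) : Prop where
  unit : x .e1 + x .e2 = 1
  idem1 : x .e1 * x .e1 = x .e1
  idem2 : x .e2 * x .e2 = x .e2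
  orth12 : x .e1 * x .e2 = 0
  orth21 : x .e2 * x .e1 = 0
  aL : x .e1 * x .a = x .a
  aR : x .a * x .e1 = x .a
  bL : x .e1 * x .b = x .b
  bR : x .b * x .e2 = x .b
  gL : x .e2 * x .g = x .g
  gR : x .g * x .e1 = x .g
  hL : x .e2 * x .h = x .h
  hR : x .h * x .e2 = x .h
  bh : x .b * x .h = (x .a * x .b * x .g) ^ (k - 1) * (x .a * x .b)
  gb : x .g * x .b = x .h ^ (t - 1)
  hg : x .h * x .g = (x .g * x .a * x .b) ^ (k - 1) * (x .g * x .a)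
  bh2 : x .b * x .h * x .h = 0
  h2g : x .h * x .h * x .g = 0
  asq : x .a * x .a = c • (x .a * x .b * x .g) ^ k

/-- The images of the generators in `BA`. -/
def genBA (k t : ℕ) (c : F) (s : Gen) : BA F k t c := mk F k t c (gen F s)

theorem mk_eq_of_rel {k t : ℕ} {c : F} {u v : FreeAlgebra F Gen} (h : Rel F k t c u v) :
    mk F k t c u = mk F k t c v :=
  RingQuot.mkAlgHom_rel F h

theorem rels_genBA (k t : ℕ) (c : F) : Rels k t c (genBA k t c) := by
  constructor
  · simpa [genBA] using mk_eq_of_rel (Rel.unit (F := F) (k := k) (t := t) (c := c))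
  · simpa [genBA] using mk_eq_of_rel (Rel.idem1 (F := F) (k := k) (t := t) (c := c))
  · simpa [genBA] using mk_eq_of_rel (Rel.idem2 (F := F) (k := k) (t := t) (c := c))
  · simpa [genBA] using mk_eq_of_rel (Rel.orth12 (F := F) (k := k) (t := t) (c := c))
  · simpa [genBA] using mk_eq_of_rel (Rel.orth21 (F := F) (k := k) (t := t) (c := c))
  · simpa [genBA] using mk_eq_of_rel (Rel.aL (F := F) (k := k) (t := t) (c := c))
  · simpa [genBA] using mk_eq_of_rel (Rel.aR (F := F) (k := k) (t := t) (c := c))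
  · simpa [genBA] using mk_eq_of_rel (Rel.bL (F := F) (k := k) (t := t) (c := c))
  · simpa [genBA] using mk_eq_of_rel (Rel.bR (F := F) (k := k) (t := t) (c := c))
  · simpa [genBA] using mk_eq_of_rel (Rel.gL (F := F) (k := k) (t := t) (c := c))
  · simpa [genBA] using mk_eq_of_rel (Rel.gR (F := F) (k := k) (t := t) (c := c))
  · simpa [genBA] using mk_eq_of_rel (Rel.hL (F := F) (k := k) (t := t) (c := c))
  · simpa [genBA] using mk_eq_of_rel (Rel.hR (F := F) (k := k) (t := t) (c := c))
  · simpa [genBA] using mk_eq_of_rel (Rel.bh (F := F) (k := k) (t := t) (c := c))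
  · simpa [genBA] using mk_eq_of_rel (Rel.gb (F := F) (k := k) (t := t) (c := c))
  · simpa [genBA] using mk_eq_of_rel (Rel.hg (F := F) (k := k) (t := t) (c := c))
  · simpa [genBA] using mk_eq_of_rel (Rel.bh2 (F := F) (k := k) (t := t) (c := c))
  · simpa [genBA] using mk_eq_of_rel (Rel.h2g (F := F) (k := k) (t := t) (c := c))
  · simpa [genBA] using mk_eq_of_rel (Rel.asq (F := F) (k := k) (t := t) (c := c))

variable {k t c} {x : Gen → R}

/-- The universal property of `BA`. -/
theorem Rels.exists_algHom (hx : Rels k t c x) :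
    ∃ f : BA F k t c →ₐ[F] R, ∀ s, f (genBA k t c s) = x s := by
  refine ⟨RingQuot.liftAlgHom F ⟨FreeAlgebra.lift F x, ?_⟩, fun s => ?_⟩
  · intro u v h
    cases h <;> simp only [gen, map_add, map_mul, map_pow, map_smul, map_one, map_zero,
      FreeAlgebra.lift_ι_apply]
    exacts [hx.unit, hx.idem1, hx.idem2, hx.orth12, hx.orth21, hx.aL, hx.aR, hx.bL, hx.bR,
      hx.gL, hx.gR, hx.hL, hx.hR, hx.bh, hx.gb, hx.hg, hx.bh2, hx.h2g, hx.asq]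
  · exact (RingQuot.liftAlgHom_mkAlgHom_apply F _ _ _).trans (FreeAlgebra.lift_ι_apply _ _)

/-- A subspace containing `1` and stable under left multiplication by the generators is
everything. -/
theorem submodule_eq_top_of_genBA_mul_mem (N : Submodule F (BA F k t c)) (h1 : 1 ∈ N)
    (hN : ∀ s, ∀ y ∈ N, genBA k t c s * y ∈ N) : N = ⊤ := by
  have key : ∀ u : FreeAlgebra F Gen, ∀ y ∈ N, mk F k t c u * y ∈ N := by
    intro u
    induction u using FreeAlgebra.induction with
    | grade0 r =>
      intro y hy
      rw [AlgHom.commutes, ← Algebra.smul_def]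
      exact N.smul_mem r hy
    | grade1 s => exact hN s
    | mul u v hu hv =>
      intro y hy
      rw [map_mul, mul_assoc]
      exact hu _ (hv y hy)
    | add u v hu hv =>
      intro y hy
      rw [map_add, add_mul]
      exact N.add_mem (hu y hy) (hv y hy)
  refine eq_top_iff.2 fun z _ => ?_
  obtain ⟨u, rfl⟩ := RingQuot.mkAlgHom_surjective F (Rel F k t c) z
  have h := key u 1 h1
  rwa [mul_one] at h

namespace Rels

/-- The path `αβγ`. -/
local notation "P" => x Gen.a * x Gen.b * x Gen.g
/-- The path `βγα`. -/
local notation "Q" => x Gen.b * x Gen.g * x Gen.a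
/-- The path `γαβ`. -/
local notation "S" => x Gen.g * x Gen.a * x Gen.b

variable (x) in
theorem a_mul_pow (m : ℕ) : x .a * Q ^ m = P ^ m * x .a :=
  (show SemiconjBy (x .a) Q P by simp [SemiconjBy, mul_assoc]).pow_right m

variable (x) in
theorem b_mul_pow (m : ℕ) : x .b * S ^ m = Q ^ m * x .b :=
  (show SemiconjBy (x .b) S Q by simp [SemiconjBy, mul_assoc]).pow_right m

variable (x) in
theorem g_mul_pow (m : ℕ) : x .g * P ^ m = S ^ m * x .g :=
  (show SemiconjBy (x .g) P S by simp [SemiconjBy, mul_assoc]).pow_right m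

theorem bhg_eq_P (hx : Rels k t c x) (hk : 1 ≤ k) : x .b * x .h * x .g = P ^ k := by
  rw [hx.bh, mul_assoc, ← pow_succ, Nat.sub_add_cancel hk]

theorem bhg_eq_Q (hx : Rels k t c x) (hk : 1 ≤ k) : x .b * x .h * x .g = Q ^ k := by
  rw [mul_assoc, hx.hg, ← mul_assoc, b_mul_pow, mul_assoc, ← mul_assoc (x .b), ← pow_succ,
    Nat.sub_add_cancel hk]

theorem P_eq_Q (hx : Rels k t c x) (hk : 1 ≤ k) : P ^ k = Q ^ k :=
  (hx.bhg_eq_P hk).symm.trans (hx.bhg_eq_Q hk)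

theorem S_eq_hgb (hx : Rels k t c x) (hk : 1 ≤ k) : S ^ k = x .h * x .g * x .b := by
  rw [hx.hg, mul_assoc (S ^ (k - 1)), ← pow_succ, Nat.sub_add_cancel hk]

theorem h_pow_eq_S (hx : Rels k t c x) (hk : 1 ≤ k) (ht : 2 ≤ t) : x .h ^ t = S ^ k := by
  rw [hx.S_eq_hgb hk, mul_assoc, hx.gb, ← pow_succ', Nat.sub_add_cancel (by omega)]

theorem b_mul_h_pow (hx : Rels k t c x) {j : ℕ} (hj : 2 ≤ j) : x .b * x .h ^ j = 0 := by
  obtain ⟨i, rfl⟩ := Nat.exists_eq_add_of_le hj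
  rw [pow_add, pow_two, ← mul_assoc, ← mul_assoc, hx.bh2, zero_mul]

theorem h_pow_mul_g (hx : Rels k t c x) {j : ℕ} (hj : 2 ≤ j) : x .h ^ j * x .g = 0 := by
  obtain ⟨i, rfl⟩ := Nat.exists_eq_add_of_le hj
  rw [add_comm, pow_add, pow_two, mul_assoc, hx.h2g, mul_zero]

theorem h_pow_eq_zero (hx : Rels k t c x) (hk : 1 ≤ k) (ht : 2 ≤ t) {j : ℕ} (hj : t < j) :
    x .h ^ j = 0 := by
  obtain ⟨i, rfl⟩ := Nat.exists_eq_add_of_le (Nat.succ_le_of_lt hj)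
  rw [pow_add, pow_succ', hx.h_pow_eq_S hk ht, hx.S_eq_hgb hk, ← mul_assoc, ← mul_assoc, hx.h2g]
  simp

theorem Q_pow_mul_b (hx : Rels k t c x) (hk : 1 ≤ k) (ht : 2 ≤ t) {m : ℕ} (hm : k ≤ m) :
    Q ^ m * x .b = 0 := by
  obtain ⟨i, rfl⟩ := Nat.exists_eq_add_of_le' hm
  rw [pow_add, mul_assoc, ← b_mul_pow x k, ← hx.h_pow_eq_S hk ht, hx.b_mul_h_pow ht, mul_zero]

theorem S_pow_mul_g (hx : Rels k t c x) (hk : 1 ≤ k) (ht : 2 ≤ t) {m : ℕ} (hm : k ≤ m) :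
    S ^ m * x .g = 0 := by
  obtain ⟨i, rfl⟩ := Nat.exists_eq_add_of_le' hm
  rw [pow_add, mul_assoc, ← hx.h_pow_eq_S hk ht, hx.h_pow_mul_g ht, mul_zero]

theorem g_mul_P_pow (hx : Rels k t c x) (hk : 1 ≤ k) (ht : 2 ≤ t) {m : ℕ} (hm : k ≤ m) :
    x .g * P ^ m = 0 := by
  rw [g_mul_pow, hx.S_pow_mul_g hk ht hm]

theorem aab (hx : Rels k t c x) (hk : 1 ≤ k) (ht : 2 ≤ t) : x .a * x .a * x .b = 0 := by
  rw [hx.asq, smul_mul_assoc, hx.P_eq_Q hk, hx.Q_pow_mul_b hk ht le_rfl, smul_zero]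

theorem gaa (hx : Rels k t c x) (hk : 1 ≤ k) (ht : 2 ≤ t) : x .g * x .a * x .a = 0 := by
  rw [mul_assoc, hx.asq, mul_smul_comm, hx.g_mul_P_pow hk ht le_rfl, smul_zero]

theorem hga (hx : Rels k t c x) (hk : 1 ≤ k) (ht : 2 ≤ t) : x .h * x .g * x .a = 0 := by
  rw [hx.hg, mul_assoc, hx.gaa hk ht, mul_zero]

theorem h_pow_mul_ga (hx : Rels k t c x) (hk : 1 ≤ k) (ht : 2 ≤ t) {j : ℕ} (hj : 1 ≤ j) :
    x .h ^ j * x .g * x .a = 0 := by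
  obtain rfl | hj := hj.eq_or_lt
  · rw [pow_one, hx.hga hk ht]
  · rw [hx.h_pow_mul_g hj, zero_mul]

theorem gbga (hx : Rels k t c x) (hk : 1 ≤ k) (ht : 2 ≤ t) :
    x .g * x .b * x .g * x .a = 0 := by
  rw [hx.gb, hx.h_pow_mul_ga hk ht (by omega)]

theorem P_pow_mul_a (hx : Rels k t c x) (hk : 1 ≤ k) (ht : 2 ≤ t) {m : ℕ}
    (hm : k ≤ m) : P ^ m * x .a = 0 := by
  obtain ⟨i, rfl⟩ := Nat.exists_eq_add_of_le' hm
  suffices h : P ^ k * x .a = 0 by rw [pow_add, mul_assoc, h, mul_zero]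
  obtain ⟨k, rfl⟩ := Nat.exists_eq_add_of_le' hk
  have h1 : P ^ (k + 1) * x .a = c • (Q ^ k * (x .b * x .g * P ^ (k + 1))) := by
    conv_lhs =>
      rw [hx.P_eq_Q hk, pow_succ Q k, mul_assoc, mul_assoc _ (x .a), hx.asq, mul_smul_comm,
        mul_smul_comm]
  rw [h1, mul_assoc (x .b) (x .g) (P ^ (k + 1)), hx.g_mul_P_pow hk ht le_rfl, mul_zero, mul_zero,
    smul_zero]

end Rels

end Relations

section Model

/-- Labels for the standard basis paths: `a i`, `ga i`, `g i`, `bg i`, `b i`, `ab i` stand for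
the paths of the form `(…)^i` times `α`, `γα`, `γ`, `βγ`, `β`, `αβ`; `bga i` for `(βγα)^i`
(with `e₁` for `i = 0`), `abg i` for `(αβγ)^(i+1)`, `gab i` for `(γαβ)^i` (with `e₂` for `i = 0`)
and `h i` for `η^(i+1)`. -/
inductive Idx (k t : ℕ) : Type
  | a (i : Fin k)
  | ga (i : Fin k)
  | g (i : Fin k)
  | bg (i : Fin k)
  | b (i : Fin k)
  | ab (i : Fin k)
  | bga (i : Fin (k + 1))
  | abg (i : Fin (k - 1))
  | gab (i : Fin (k + 1))
  | h (i : Fin (t - 1))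

namespace Idx

/-- `Idx` as a sum of finite types. -/
def equivSum (k t : ℕ) : Idx k t ≃ (Fin k ⊕ Fin k ⊕ Fin k ⊕ Fin k ⊕ Fin k ⊕ Fin k) ⊕
    Fin (k + 1) ⊕ Fin (k - 1) ⊕ Fin (k + 1) ⊕ Fin (t - 1) where
  toFun
    | a i => .inl (.inl i)
    | ga i => .inl (.inr (.inl i))
    | g i => .inl (.inr (.inr (.inl i)))
    | bg i => .inl (.inr (.inr (.inr (.inl i))))
    | b i => .inl (.inr (.inr (.inr (.inr (.inl i)))))
    | ab i => .inl (.inr (.inr (.inr (.inr (.inr i)))))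
    | bga i => .inr (.inl i)
    | abg i => .inr (.inr (.inl i))
    | gab i => .inr (.inr (.inr (.inl i)))
    | h i => .inr (.inr (.inr (.inr i)))
  invFun
    | .inl (.inl i) => a i
    | .inl (.inr (.inl i)) => ga i
    | .inl (.inr (.inr (.inl i))) => g i
    | .inl (.inr (.inr (.inr (.inl i)))) => bg i
    | .inl (.inr (.inr (.inr (.inr (.inl i))))) => b i
    | .inl (.inr (.inr (.inr (.inr (.inr i))))) => ab i
    | .inr (.inl i) => bga i
    | .inr (.inr (.inl i)) => abg i
    | .inr (.inr (.inr (.inl i))) => gab i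
    | .inr (.inr (.inr (.inr i))) => h i
  left_inv i := by cases i <;> rfl
  right_inv i := by rcases i with (_ | _ | _ | _ | _ | _) | _ | _ | _ | _ <;> rfl

instance (k t : ℕ) : Fintype (Idx k t) := Fintype.ofEquiv _ (equivSum k t).symm

theorem card (k t : ℕ) (hk : 1 ≤ k) (ht : 2 ≤ t) : Fintype.card (Idx k t) = 9 * k + t := by
  rw [Fintype.card_congr (equivSum k t)]
  simp only [Fintype.card_sum, Fintype.card_fin]
  omega

end Idx

variable {k t}

/-- The basis vector labelled `C m`, or `0` when `m` is out of range. -/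
def vec {n : ℕ} (C : Fin n → Idx k t) (m : ℕ) : Idx k t →₀ F :=
  if h : m < n then Finsupp.single (C ⟨m, h⟩) 1 else 0

/-- The vector of the path `(αβγ)^m` (`e₁` for `m = 0`). -/
def vecABG (m : ℕ) : Idx k t →₀ F :=
  if m = 0 then vec F .bga 0 else if m = k then vec F .bga k else vec F .abg (m - 1)

/-- The vector of the path `η^m` (`e₂` for `m = 0`). -/
def vecH (m : ℕ) : Idx k t →₀ F :=
  if m = 0 then vec F .gab 0 else if m = t then vec F .gab k else vec F .h (m - 1)

variable {F}

theorem single_eq_vec {n : ℕ} (C : Fin n → Idx k t) (i : Fin n) :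
    Finsupp.single (C i) 1 = vec F C i := by
  simp [vec]

theorem vec_of_le {n m : ℕ} (C : Fin n → Idx k t) (h : n ≤ m) : vec F C m = 0 := by
  simp [vec, h]

theorem linearCombination_vec {V : Type} [AddCommGroup V] [Module F V] (f : Idx k t → V)
    {n : ℕ} (C : Fin n → Idx k t) (m : ℕ) :
    Finsupp.linearCombination F f (vec F C m) = if h : m < n then f (C ⟨m, h⟩) else 0 := by
  unfold vec
  split_ifs <;> simp

/-- Left multiplication of the standard basis paths by the generators. -/
def act (c : F) : Gen → Idx k t → (Idx k t →₀ F)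
  | .e1, .a i => vec F .a i
  | .e1, .bg i => vec F .bg i
  | .e1, .b i => vec F .b i
  | .e1, .ab i => vec F .ab i
  | .e1, .bga i => vec F .bga i
  | .e1, .abg i => vec F .abg i
  | .e2, .ga i => vec F .ga i
  | .e2, .g i => vec F .g i
  | .e2, .gab i => vec F .gab i
  | .e2, .h i => vec F .h i
  | .a, .a i => if (i : ℕ) = 0 then c • vec F .bga k else 0
  | .a, .bg i => vecABG F (i + 1)
  | .a, .b i => vec F .ab i
  | .a, .bga i => vec F .a i
  | .b, .ga i => vec F .bga (i + 1)
  | .b, .g i => vec F .bg i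
  | .b, .gab i => vec F .b i
  | .b, .h i => if (i : ℕ) = 0 then vec F .ab (k - 1) else 0
  | .g, .a i => vec F .ga i
  | .g, .bga i => if (i : ℕ) = 0 then vec F .g 0 else 0
  | .g, .abg i => vec F .g (i + 1)
  | .g, .bg i => if (i : ℕ) = 0 ∧ t = 2 then vec F .ga (k - 1) else 0
  | .g, .b i => if (i : ℕ) = 0 then vecH F (t - 1) else 0
  | .g, .ab i => vec F .gab (i + 1)
  | .h, .g i => if (i : ℕ) = 0 then vec F .ga (k - 1) else 0
  | .h, .gab i => if (i : ℕ) = 0 then vecH F 1 else 0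
  | .h, .h i => vecH F (i + 2)
  | _, _ => 0

/-- The operator of left multiplication by a generator. -/
def op (k t : ℕ) (c : F) (s : Gen) : Module.End F (Idx k t →₀ F) :=
  Finsupp.linearCombination F (act c s)

variable {c}

theorem op_vec (s : Gen) {n : ℕ} (C : Fin n → Idx k t) (m : ℕ) :
    op k t c s (vec F C m) = if h : m < n then act c s (C ⟨m, h⟩) else 0 :=
  linearCombination_vec _ _ _

theorem vecABG_of_lt {m : ℕ} (h : k < m) : vecABG F m = (0 : Idx k t →₀ F) := by
  rw [vecABG, if_neg (by omega), if_neg (by omega), vec_of_le _ (by omega)]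

theorem vecABG_self (hk : 1 ≤ k) : vecABG F k = (vec F .bga k : Idx k t →₀ F) := by
  rw [vecABG, if_neg (by omega), if_pos rfl]

theorem vecABG_zero : vecABG F 0 = (vec F .bga 0 : Idx k t →₀ F) := rfl

theorem vecH_zero : vecH F 0 = (vec F .gab 0 : Idx k t →₀ F) := rfl

theorem vecH_self (ht : 2 ≤ t) : vecH F t = (vec F .gab k : Idx k t →₀ F) := by
  rw [vecH, if_neg (by omega), if_pos rfl]

theorem vecH_of_lt {m : ℕ} (h : t < m) : vecH F m = (0 : Idx k t →₀ F) := by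
  rw [vecH, if_neg (by omega), if_neg (by omega), vec_of_le _ (by omega)]

section Table

/-! The multiplication table, for all exponents. -/

@[simp] theorem op_e1_a (m : ℕ) : op k t c .e1 (vec F .a m) = vec F .a m := by
  rw [op_vec]
  split_ifs <;> simp_all [act]
  grind [vec_of_le, vecABG_of_lt]

@[simp] theorem op_e1_ga (m : ℕ) : op k t c .e1 (vec F .ga m) = 0 := by
  simp [op_vec, act]

@[simp] theorem op_e1_g (m : ℕ) : op k t c .e1 (vec F .g m) = 0 := by
  simp [op_vec, act]

@[simp] theorem op_e1_bg (m : ℕ) : op k t c .e1 (vec F .bg m) = vec F .bg m := by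
  rw [op_vec]
  split_ifs <;> simp_all [act]
  grind [vec_of_le, vecABG_of_lt]

@[simp] theorem op_e1_b (m : ℕ) : op k t c .e1 (vec F .b m) = vec F .b m := by
  rw [op_vec]
  split_ifs <;> simp_all [act]
  grind [vec_of_le, vecABG_of_lt]

@[simp] theorem op_e1_ab (m : ℕ) : op k t c .e1 (vec F .ab m) = vec F .ab m := by
  rw [op_vec]
  split_ifs <;> simp_all [act]
  grind [vec_of_le, vecABG_of_lt]

@[simp] theorem op_e1_bga (m : ℕ) : op k t c .e1 (vec F .bga m) = vec F .bga m := by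
  rw [op_vec]
  split_ifs <;> simp_all [act]
  grind [vec_of_le, vecABG_of_lt]

@[simp] theorem op_e1_abg (hk : 1 ≤ k) (m : ℕ) : op k t c .e1 (vecABG F m) = vecABG F m := by
  unfold vecABG
  split_ifs <;> simp_all [op_vec, act]
  grind [vec_of_le]

@[simp] theorem op_e1_gab (m : ℕ) : op k t c .e1 (vec F .gab m) = 0 := by
  simp [op_vec, act]

@[simp] theorem op_e1_h (m : ℕ) : op k t c .e1 (vecH F m) = 0 := by
  unfold vecH
  split_ifs <;> simp [op_vec, act]

@[simp] theorem op_e2_a (m : ℕ) : op k t c .e2 (vec F .a m) = 0 := by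
  simp [op_vec, act]

@[simp] theorem op_e2_ga (m : ℕ) : op k t c .e2 (vec F .ga m) = vec F .ga m := by
  rw [op_vec]
  split_ifs <;> simp_all [act]
  grind [vec_of_le, vecABG_of_lt]

@[simp] theorem op_e2_g (m : ℕ) : op k t c .e2 (vec F .g m) = vec F .g m := by
  rw [op_vec]
  split_ifs <;> simp_all [act]
  grind [vec_of_le, vecABG_of_lt]

@[simp] theorem op_e2_bg (m : ℕ) : op k t c .e2 (vec F .bg m) = 0 := by
  simp [op_vec, act]

@[simp] theorem op_e2_b (m : ℕ) : op k t c .e2 (vec F .b m) = 0 := by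
  simp [op_vec, act]

@[simp] theorem op_e2_ab (m : ℕ) : op k t c .e2 (vec F .ab m) = 0 := by
  simp [op_vec, act]

@[simp] theorem op_e2_bga (m : ℕ) : op k t c .e2 (vec F .bga m) = 0 := by
  simp [op_vec, act]

@[simp] theorem op_e2_abg (m : ℕ) : op k t c .e2 (vecABG F m) = 0 := by
  unfold vecABG
  split_ifs <;> simp [op_vec, act]

@[simp] theorem op_e2_gab (m : ℕ) : op k t c .e2 (vec F .gab m) = vec F .gab m := by
  rw [op_vec]
  split_ifs <;> simp_all [act]
  grind [vec_of_le, vecABG_of_lt]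

@[simp] theorem op_e2_h (ht : 2 ≤ t) (m : ℕ) : op k t c .e2 (vecH F m) = vecH F m := by
  unfold vecH
  split_ifs <;> simp_all [op_vec, act]
  grind [vec_of_le, vecH]

@[simp] theorem op_a_a (hk : 1 ≤ k) (m : ℕ) :
    op k t c .a (vec F .a m) = if m = 0 then c • vec F .bga k else 0 := by
  rw [op_vec]
  split_ifs <;> simp_all [act]

@[simp] theorem op_a_ga (m : ℕ) : op k t c .a (vec F .ga m) = 0 := by
  simp [op_vec, act]

@[simp] theorem op_a_g (m : ℕ) : op k t c .a (vec F .g m) = 0 := by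
  simp [op_vec, act]

@[simp] theorem op_a_bg (m : ℕ) : op k t c .a (vec F .bg m) = vecABG F (m + 1) := by
  rw [op_vec]
  split_ifs <;> simp_all [act]
  grind [vec_of_le, vecABG_of_lt]

@[simp] theorem op_a_b (m : ℕ) : op k t c .a (vec F .b m) = vec F .ab m := by
  rw [op_vec]
  split_ifs <;> simp_all [act]
  grind [vec_of_le, vecABG_of_lt]

@[simp] theorem op_a_ab (m : ℕ) : op k t c .a (vec F .ab m) = 0 := by
  simp [op_vec, act]

@[simp] theorem op_a_bga (m : ℕ) : op k t c .a (vec F .bga m) = vec F .a m := by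
  rw [op_vec]
  split_ifs <;> simp_all [act]
  grind [vec_of_le, vecABG_of_lt]

@[simp] theorem op_a_abg (m : ℕ) :
    op k t c .a (vecABG F m) = if m = 0 then vec F .a 0 else 0 := by
  unfold vecABG
  split_ifs <;> simp_all [op_vec, act]
  grind [vec_of_le]

@[simp] theorem op_a_gab (m : ℕ) : op k t c .a (vec F .gab m) = 0 := by
  simp [op_vec, act]

@[simp] theorem op_a_h (m : ℕ) : op k t c .a (vecH F m) = 0 := by
  unfold vecH
  split_ifs <;> simp [op_vec, act]

@[simp] theorem op_b_a (m : ℕ) : op k t c .b (vec F .a m) = 0 := by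
  simp [op_vec, act]

@[simp] theorem op_b_ga (m : ℕ) : op k t c .b (vec F .ga m) = vec F .bga (m + 1) := by
  rw [op_vec]
  split_ifs <;> simp_all [act]
  grind [vec_of_le, vecABG_of_lt]

@[simp] theorem op_b_g (m : ℕ) : op k t c .b (vec F .g m) = vec F .bg m := by
  rw [op_vec]
  split_ifs <;> simp_all [act]
  grind [vec_of_le, vecABG_of_lt]

@[simp] theorem op_b_bg (m : ℕ) : op k t c .b (vec F .bg m) = 0 := by
  simp [op_vec, act]

@[simp] theorem op_b_b (m : ℕ) : op k t c .b (vec F .b m) = 0 := by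
  simp [op_vec, act]

@[simp] theorem op_b_ab (m : ℕ) : op k t c .b (vec F .ab m) = 0 := by
  simp [op_vec, act]

@[simp] theorem op_b_bga (m : ℕ) : op k t c .b (vec F .bga m) = 0 := by
  simp [op_vec, act]

@[simp] theorem op_b_abg (m : ℕ) : op k t c .b (vecABG F m) = 0 := by
  unfold vecABG
  split_ifs <;> simp [op_vec, act]

@[simp] theorem op_b_gab (m : ℕ) : op k t c .b (vec F .gab m) = vec F .b m := by
  rw [op_vec]
  split_ifs <;> simp_all [act]
  grind [vec_of_le, vecABG_of_lt]

@[simp] theorem op_b_h (ht : 2 ≤ t) (m : ℕ) :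
    op k t c .b (vecH F m) =
      if m = 0 then vec F .b 0 else if m = 1 then vec F .ab (k - 1) else 0 := by
  unfold vecH
  split_ifs <;> simp_all [op_vec, act] <;> grind [vec_of_le, vecH]

@[simp] theorem op_g_a (m : ℕ) : op k t c .g (vec F .a m) = vec F .ga m := by
  rw [op_vec]
  split_ifs <;> simp_all [act]
  grind [vec_of_le, vecABG_of_lt]

@[simp] theorem op_g_ga (m : ℕ) : op k t c .g (vec F .ga m) = 0 := by
  simp [op_vec, act]

@[simp] theorem op_g_g (m : ℕ) : op k t c .g (vec F .g m) = 0 := by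
  simp [op_vec, act]

@[simp] theorem op_g_bg (hk : 1 ≤ k) (m : ℕ) :
    op k t c .g (vec F .bg m) = if m = 0 ∧ t = 2 then vec F .ga (k - 1) else 0 := by
  rw [op_vec]
  split_ifs <;> simp_all [act]

@[simp] theorem op_g_b (hk : 1 ≤ k) (m : ℕ) :
    op k t c .g (vec F .b m) = if m = 0 then vecH F (t - 1) else 0 := by
  rw [op_vec]
  split_ifs <;> simp_all [act]

@[simp] theorem op_g_ab (m : ℕ) : op k t c .g (vec F .ab m) = vec F .gab (m + 1) := by
  rw [op_vec]
  split_ifs <;> simp_all [act]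
  grind [vec_of_le, vecABG_of_lt]

@[simp] theorem op_g_bga (m : ℕ) :
    op k t c .g (vec F .bga m) = if m = 0 then vec F .g 0 else 0 := by
  rw [op_vec]
  split_ifs <;> simp_all [act]

@[simp] theorem op_g_abg (hk : 1 ≤ k) (m : ℕ) : op k t c .g (vecABG F m) = vec F .g m := by
  unfold vecABG
  split_ifs <;> simp_all [op_vec, act] <;> grind [vec_of_le]

@[simp] theorem op_g_gab (m : ℕ) : op k t c .g (vec F .gab m) = 0 := by
  simp [op_vec, act]

@[simp] theorem op_g_h (m : ℕ) : op k t c .g (vecH F m) = 0 := by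
  unfold vecH
  split_ifs <;> simp [op_vec, act]

@[simp] theorem op_h_a (m : ℕ) : op k t c .h (vec F .a m) = 0 := by
  simp [op_vec, act]

@[simp] theorem op_h_ga (m : ℕ) : op k t c .h (vec F .ga m) = 0 := by
  simp [op_vec, act]

@[simp] theorem op_h_g (hk : 1 ≤ k) (m : ℕ) :
    op k t c .h (vec F .g m) = if m = 0 then vec F .ga (k - 1) else 0 := by
  rw [op_vec]
  split_ifs <;> simp_all [act]

@[simp] theorem op_h_bg (m : ℕ) : op k t c .h (vec F .bg m) = 0 := by
  simp [op_vec, act]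

@[simp] theorem op_h_b (m : ℕ) : op k t c .h (vec F .b m) = 0 := by
  simp [op_vec, act]

@[simp] theorem op_h_ab (m : ℕ) : op k t c .h (vec F .ab m) = 0 := by
  simp [op_vec, act]

@[simp] theorem op_h_bga (m : ℕ) : op k t c .h (vec F .bga m) = 0 := by
  simp [op_vec, act]

@[simp] theorem op_h_abg (m : ℕ) : op k t c .h (vecABG F m) = 0 := by
  unfold vecABG
  split_ifs <;> simp [op_vec, act]

@[simp] theorem op_h_gab (m : ℕ) : op k t c .h (vec F .gab m) = if m = 0 then vecH F 1 else 0 := by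
  rw [op_vec]
  split_ifs <;> simp_all [act]

@[simp] theorem op_h_h (hk : 1 ≤ k) (ht : 2 ≤ t) (m : ℕ) :
    op k t c .h (vecH F m) = vecH F (m + 1) := by
  unfold vecH
  split_ifs <;> simp_all [op_vec, act] <;> grind [vec_of_le, vecH]

end Table

theorem pow_apply_of_succ {V : Type} [AddCommGroup V] [Module F V] {f : Module.End F V}
    {v : ℕ → V} (h : ∀ n, f (v n) = v (n + 1)) (m n : ℕ) : (f ^ m) (v n) = v (n + m) := by
  induction m generalizing n with
  | zero => simp
  | succ m ih => rw [pow_succ, Module.End.mul_apply, h, ih]; congr 1; omega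

@[simp] theorem op_ite (s : Gen) (p : Prop) [Decidable p] (v : Idx k t →₀ F) :
    op k t c s (if p then v else 0) = if p then op k t c s v else 0 := by
  split_ifs <;> simp

/-- Linear maps on the model agree if they agree on all vectors of paths. -/
theorem model_hom_ext {V : Type} [AddCommGroup V] [Module F V] (hk : 1 ≤ k)
    {f f' : (Idx k t →₀ F) →ₗ[F] V}
    (a : ∀ m, f (vec F .a m) = f' (vec F .a m)) (ga : ∀ m, f (vec F .ga m) = f' (vec F .ga m))
    (g : ∀ m, f (vec F .g m) = f' (vec F .g m)) (bg : ∀ m, f (vec F .bg m) = f' (vec F .bg m))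
    (b : ∀ m, f (vec F .b m) = f' (vec F .b m)) (ab : ∀ m, f (vec F .ab m) = f' (vec F .ab m))
    (bga : ∀ m, f (vec F .bga m) = f' (vec F .bga m))
    (abg : ∀ m, f (vecABG F (m + 1)) = f' (vecABG F (m + 1)))
    (gab : ∀ m, f (vec F .gab m) = f' (vec F .gab m))
    (h : ∀ m, f (vecH F (m + 1)) = f' (vecH F (m + 1))) : f = f' := by
  refine Finsupp.lhom_ext' fun i => LinearMap.ext_ring ?_
  simp only [LinearMap.comp_apply, Finsupp.lsingle_apply]
  cases i with
  | a i => rw [single_eq_vec, a]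
  | ga i => rw [single_eq_vec, ga]
  | g i => rw [single_eq_vec, g]
  | bg i => rw [single_eq_vec, bg]
  | b i => rw [single_eq_vec, b]
  | ab i => rw [single_eq_vec, ab]
  | bga i => rw [single_eq_vec, bga]
  | gab i => rw [single_eq_vec, gab]
  | abg i =>
    have := abg i
    rwa [vecABG, if_neg (by omega), if_neg (by omega), Nat.add_sub_cancel, ← single_eq_vec] at this
  | h i =>
    have := h i
    rwa [vecH, if_neg (by omega), if_neg (by omega), Nat.add_sub_cancel, ← single_eq_vec] at this

local notation "P" => op k t c Gen.a * op k t c Gen.b * op k t c Gen.g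
local notation "Q" => op k t c Gen.b * op k t c Gen.g * op k t c Gen.a
local notation "S" => op k t c Gen.g * op k t c Gen.a * op k t c Gen.b

theorem P_pow_a (m n : ℕ) : (P ^ m) (vec F .a n) = vec F .a (n + m) :=
  pow_apply_of_succ (v := vec F .a) (by simp) m n

theorem P_pow_ab (m n : ℕ) : (P ^ m) (vec F .ab n) = vec F .ab (n + m) :=
  pow_apply_of_succ (v := vec F .ab) (by simp) m n

theorem P_pow_abg (hk : 1 ≤ k) (m n : ℕ) : (P ^ m) (vecABG F n) = vecABG F (n + m) :=
  pow_apply_of_succ (v := vecABG F) (by simp [hk]) m n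

theorem Q_pow_b (m n : ℕ) : (Q ^ m) (vec F .b n) = vec F .b (n + m) :=
  pow_apply_of_succ (v := vec F .b) (by simp) m n

theorem Q_pow_bg (hk : 1 ≤ k) (m n : ℕ) : (Q ^ m) (vec F .bg n) = vec F .bg (n + m) :=
  pow_apply_of_succ (v := vec F .bg) (fun n => by simp [hk]) m n

theorem Q_pow_bga (m n : ℕ) : (Q ^ m) (vec F .bga n) = vec F .bga (n + m) :=
  pow_apply_of_succ (v := vec F .bga) (by simp) m n

theorem S_pow_g (hk : 1 ≤ k) (m n : ℕ) : (S ^ m) (vec F .g n) = vec F .g (n + m) :=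
  pow_apply_of_succ (v := vec F .g) (fun n => by simp [hk]) m n

theorem S_pow_ga (m n : ℕ) : (S ^ m) (vec F .ga n) = vec F .ga (n + m) :=
  pow_apply_of_succ (v := vec F .ga) (by simp) m n

theorem S_pow_gab (m n : ℕ) : (S ^ m) (vec F .gab n) = vec F .gab (n + m) :=
  pow_apply_of_succ (v := vec F .gab) (by simp) m n

theorem h_pow_h (hk : 1 ≤ k) (ht : 2 ≤ t) (m n : ℕ) :
    (op k t c .h ^ m) (vecH F n) = vecH F (n + m) :=
  pow_apply_of_succ (v := vecH F) (op_h_h hk ht) m n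

theorem pow_apply_eq_zero {V : Type} [AddCommGroup V] [Module F V] {f : Module.End F V} {v : V}
    {m : ℕ} (hm : 1 ≤ m) (h : f v = 0) : (f ^ m) v = 0 := by
  obtain ⟨n, rfl⟩ := Nat.exists_eq_add_of_le' hm
  rw [pow_succ, Module.End.mul_apply, h, map_zero]

/-- The operators on the model satisfy the relations. -/
theorem rels_op (hk : 1 ≤ k) (ht : 2 ≤ t) : Rels k t c (op k t c) where
  unit := by apply model_hom_ext hk <;> intro m <;> simp [hk, ht]
  idem1 := by apply model_hom_ext hk <;> intro m <;> simp [hk]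
  idem2 := by apply model_hom_ext hk <;> intro m <;> simp [ht]
  orth12 := by apply model_hom_ext hk <;> intro m <;> simp [ht]
  orth21 := by apply model_hom_ext hk <;> intro m <;> simp [hk]
  aL := by apply model_hom_ext hk <;> intro m <;> simp [hk]
  aR := by apply model_hom_ext hk <;> intro m <;> simp [hk]
  bL := by apply model_hom_ext hk <;> intro m <;> simp [ht]
  bR := by apply model_hom_ext hk <;> intro m <;> simp [ht]
  gL := by apply model_hom_ext hk <;> intro m <;> simp [hk, ht]
  gR := by apply model_hom_ext hk <;> intro m <;> simp [hk]
  hL := by apply model_hom_ext hk <;> intro m <;> simp [hk, ht]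
  hR := by apply model_hom_ext hk <;> intro m <;> simp [hk, ht]
  bh := by
    apply model_hom_ext hk <;> intro m <;> simp [hk, ht]
    · rw [P_pow_a, vec_of_le _ (by omega)]
    · rw [P_pow_abg hk, show m + 1 + (k - 1) = m + k by omega]
      split_ifs with hm
      · rw [hm, zero_add, vecABG_self hk]
      · rw [vecABG_of_lt (by omega)]
    · rw [P_pow_ab]
      split_ifs with hm
      · rw [hm, zero_add]
      · rw [vec_of_le _ (by omega)]
  gb := by
    have h1 : 1 ≤ t - 1 := by omega
    apply model_hom_ext hk <;> intro m
    case g =>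
      obtain rfl | ht' := ht.eq_or_lt
      · simp [hk]
      · obtain ⟨n, rfl⟩ := Nat.exists_eq_add_of_lt ht'
        rw [show 2 + n + 1 - 1 = n + 1 + 1 by omega, pow_succ, pow_succ]
        simp [hk]
        omega
    case gab =>
      have h2 := h_pow_h hk ht (c := c) (t - 1) 0
      rw [vecH_zero, zero_add] at h2
      by_cases hm : m = 0
      · simp [hk, hm, h2]
      · rw [pow_apply_eq_zero h1 (by simp [hm])]
        simp [hk, hm]
    case h =>
      rw [h_pow_h hk ht, show m + 1 + (t - 1) = m + t by omega]
      by_cases hm : m = 0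
      · simp [hm, ht, vecH_self ht, Nat.sub_add_cancel hk]
      · simp [hm, ht, vecH_of_lt (show t < m + t by omega)]
    all_goals
      rw [pow_apply_eq_zero h1 (by simp)]
      simp
  hg := by
    apply model_hom_ext hk <;> intro m <;> simp [hk, ht]
    · simp [show k ≠ 0 by omega]
    · rw [S_pow_g hk, vec_of_le _ (by omega)]
    · rw [S_pow_gab, show m + 1 + (k - 1) = m + k by omega, Nat.sub_add_cancel (by omega)]
      split_ifs with hm
      · rw [hm, zero_add, vecH_self ht]
      · rw [vec_of_le _ (by omega)]
    · rw [S_pow_ga]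
      split_ifs with hm
      · rw [hm, zero_add]
      · rw [vec_of_le _ (by omega)]
  bh2 := by apply model_hom_ext hk <;> intro m <;> simp [hk, ht]
  h2g := by
    apply model_hom_ext hk <;> intro m <;> simp [hk, ht]
    intro
    exact vecH_of_lt (by omega)
  asq := by
    apply model_hom_ext hk <;> intro m <;> simp only [LinearMap.smul_apply]
    case a =>
      rw [P_pow_a, vec_of_le _ (show k ≤ m + k by omega)]
      simp [hk, vec_of_le]
    case ab =>
      rw [P_pow_ab, vec_of_le _ (show k ≤ m + k by omega)]
      simp
    case abg =>
      rw [P_pow_abg hk, vecABG_of_lt (show k < m + 1 + k by omega)]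
      simp
    case bga =>
      by_cases hm : m = 0
      · have h := P_pow_abg hk (c := c) (t := t) k 0
        rw [vecABG_zero, zero_add, vecABG_self hk] at h
        simp [hm, h, hk]
      · rw [pow_apply_eq_zero hk (by simp [hm])]
        simp [hm, hk]
    all_goals
      rw [pow_apply_eq_zero hk (by simp [hk, ht, vec_of_le, show t - 1 ≠ 0 by omega])]
      simp

end Model

section Paths

variable {F} {k t c} {R : Type} [Ring R] [Algebra F R] {x : Gen → R}

/-- The standard paths, in the letters `x`. -/
def path (k t : ℕ) (x : Gen → R) : Idx k t → R
  | .a i => (x .a * x .b * x .g) ^ (i : ℕ) * x .a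
  | .ga i => (x .g * x .a * x .b) ^ (i : ℕ) * (x .g * x .a)
  | .g i => (x .g * x .a * x .b) ^ (i : ℕ) * x .g
  | .bg i => (x .b * x .g * x .a) ^ (i : ℕ) * (x .b * x .g)
  | .b i => (x .b * x .g * x .a) ^ (i : ℕ) * x .b
  | .ab i => (x .a * x .b * x .g) ^ (i : ℕ) * (x .a * x .b)
  | .bga i => x .e1 * (x .b * x .g * x .a) ^ (i : ℕ)
  | .abg i => (x .a * x .b * x .g) ^ ((i : ℕ) + 1)
  | .gab i => x .e2 * (x .g * x .a * x .b) ^ (i : ℕ)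
  | .h i => x .h ^ ((i : ℕ) + 1)

theorem mul_pow_eq_zero {y p : R} (h : y * p = 0) {m : ℕ} (hm : m ≠ 0) : y * p ^ m = 0 := by
  obtain ⟨m, rfl⟩ := Nat.exists_eq_succ_of_ne_zero hm
  rw [pow_succ', ← mul_assoc, h, zero_mul]

namespace Rels

local notation "P" => x Gen.a * x Gen.b * x Gen.g
local notation "Q" => x Gen.b * x Gen.g * x Gen.a
local notation "S" => x Gen.g * x Gen.a * x Gen.b

theorem e1_mul_P_pow_succ (hx : Rels k t c x) (m : ℕ) : x .e1 * P ^ (m + 1) = P ^ (m + 1) := by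
  rw [pow_succ']
  simp only [← mul_assoc, hx.aL]

theorem e1_mul_Q_pow_succ (hx : Rels k t c x) (m : ℕ) : x .e1 * Q ^ (m + 1) = Q ^ (m + 1) := by
  rw [pow_succ']
  simp only [← mul_assoc, hx.bL]

theorem e2_mul_S_pow_succ (hx : Rels k t c x) (m : ℕ) : x .e2 * S ^ (m + 1) = S ^ (m + 1) := by
  rw [pow_succ']
  simp only [← mul_assoc, hx.gL]

theorem e2_mul_h_pow_succ (hx : Rels k t c x) (m : ℕ) :
    x .e2 * x .h ^ (m + 1) = x .h ^ (m + 1) := by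
  rw [pow_succ', ← mul_assoc, hx.hL]

theorem linearCombination_vec_a (hx : Rels k t c x) (hk : 1 ≤ k) (ht : 2 ≤ t) (m : ℕ) :
    Finsupp.linearCombination F (path k t x) (vec F .a m) = P ^ m * x .a := by
  rw [linearCombination_vec]
  split_ifs with h
  · rfl
  · rw [hx.P_pow_mul_a hk ht (not_lt.1 h)]

theorem linearCombination_vec_g (hx : Rels k t c x) (hk : 1 ≤ k) (ht : 2 ≤ t) (m : ℕ) :
    Finsupp.linearCombination F (path k t x) (vec F .g m) = S ^ m * x .g := by
  rw [linearCombination_vec]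
  split_ifs with h
  · rfl
  · rw [hx.S_pow_mul_g hk ht (not_lt.1 h)]

theorem linearCombination_vec_ga (hx : Rels k t c x) (hk : 1 ≤ k) (ht : 2 ≤ t) (m : ℕ) :
    Finsupp.linearCombination F (path k t x) (vec F .ga m) = S ^ m * (x .g * x .a) := by
  rw [linearCombination_vec]
  split_ifs with h
  · rfl
  · rw [← mul_assoc, hx.S_pow_mul_g hk ht (not_lt.1 h), zero_mul]

theorem linearCombination_vec_b (hx : Rels k t c x) (hk : 1 ≤ k) (ht : 2 ≤ t) (m : ℕ) :
    Finsupp.linearCombination F (path k t x) (vec F .b m) = Q ^ m * x .b := by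
  rw [linearCombination_vec]
  split_ifs with h
  · rfl
  · rw [hx.Q_pow_mul_b hk ht (not_lt.1 h)]

theorem linearCombination_vec_bg (hx : Rels k t c x) (hk : 1 ≤ k) (ht : 2 ≤ t) (m : ℕ) :
    Finsupp.linearCombination F (path k t x) (vec F .bg m) = Q ^ m * (x .b * x .g) := by
  rw [linearCombination_vec]
  split_ifs with h
  · rfl
  · rw [← mul_assoc, hx.Q_pow_mul_b hk ht (not_lt.1 h), zero_mul]

theorem linearCombination_vec_ab (hx : Rels k t c x) (hk : 1 ≤ k) (ht : 2 ≤ t) (m : ℕ) :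
    Finsupp.linearCombination F (path k t x) (vec F .ab m) = P ^ m * (x .a * x .b) := by
  rw [linearCombination_vec]
  split_ifs with h
  · rfl
  · rw [← mul_assoc, hx.P_pow_mul_a hk ht (not_lt.1 h), zero_mul]

theorem linearCombination_vec_bga (hx : Rels k t c x) (hk : 1 ≤ k) (ht : 2 ≤ t) (m : ℕ) :
    Finsupp.linearCombination F (path k t x) (vec F .bga m) = x .e1 * Q ^ m := by
  rw [linearCombination_vec]
  split_ifs with h
  · rfl
  · obtain ⟨n, rfl⟩ := Nat.exists_eq_add_of_lt (show k < m by omega)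
    rw [pow_succ, ← mul_assoc (Q ^ _), ← mul_assoc (Q ^ _), hx.Q_pow_mul_b hk ht (by omega)]
    simp only [zero_mul, mul_zero]

theorem linearCombination_vec_gab (hx : Rels k t c x) (hk : 1 ≤ k) (ht : 2 ≤ t) (m : ℕ) :
    Finsupp.linearCombination F (path k t x) (vec F .gab m) = x .e2 * S ^ m := by
  rw [linearCombination_vec]
  split_ifs with h
  · rfl
  · obtain ⟨n, rfl⟩ := Nat.exists_eq_add_of_lt (show k < m by omega)
    rw [pow_succ, ← mul_assoc (S ^ _), ← mul_assoc (S ^ _), hx.S_pow_mul_g hk ht (by omega)]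
    simp only [zero_mul, mul_zero]

theorem linearCombination_vecABG (hx : Rels k t c x) (hk : 1 ≤ k) (ht : 2 ≤ t) (m : ℕ) :
    Finsupp.linearCombination F (path k t x) (vecABG F m) = x .e1 * P ^ m := by
  unfold vecABG
  split_ifs with h1 h2
  · rw [hx.linearCombination_vec_bga hk ht, h1, pow_zero, pow_zero]
  · rw [hx.linearCombination_vec_bga hk ht, h2, hx.P_eq_Q hk]
  · obtain ⟨n, rfl⟩ := Nat.exists_eq_succ_of_ne_zero h1
    rw [linearCombination_vec, hx.e1_mul_P_pow_succ]
    split_ifs with h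
    · rfl
    · rw [pow_succ, ← mul_assoc (P ^ _), ← mul_assoc (P ^ _), hx.P_pow_mul_a hk ht (by omega)]
      simp only [zero_mul]

theorem linearCombination_vecH (hx : Rels k t c x) (hk : 1 ≤ k) (ht : 2 ≤ t) (m : ℕ) :
    Finsupp.linearCombination F (path k t x) (vecH F m) = x .e2 * x .h ^ m := by
  unfold vecH
  split_ifs with h1 h2
  · rw [hx.linearCombination_vec_gab hk ht, h1, pow_zero, pow_zero]
  · rw [hx.linearCombination_vec_gab hk ht, h2, hx.h_pow_eq_S hk ht]
  · obtain ⟨n, rfl⟩ := Nat.exists_eq_succ_of_ne_zero h1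
    rw [linearCombination_vec, hx.e2_mul_h_pow_succ]
    split_ifs with h
    · rfl
    · rw [hx.h_pow_eq_zero hk ht (by omega)]

theorem linearCombination_op (hx : Rels k t c x) (hk : 1 ≤ k) (ht : 2 ≤ t) (s : Gen)
    (v : Idx k t →₀ F) :
    Finsupp.linearCombination F (path k t x) (op k t c s v) =
      x s * Finsupp.linearCombination F (path k t x) v := by
  revert v
  suffices h : Finsupp.linearCombination F (path k t x) ∘ₗ op k t c s =
      LinearMap.mulLeft F (x s) ∘ₗ Finsupp.linearCombination F (path k t x) from
    LinearMap.congr_fun h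
  have aL (z) : x .e1 * (x .a * z) = x .a * z := by rw [← mul_assoc, hx.aL]
  have bL (z) : x .e1 * (x .b * z) = x .b * z := by rw [← mul_assoc, hx.bL]
  have gL (z) : x .e2 * (x .g * z) = x .g * z := by rw [← mul_assoc, hx.gL]
  have hP (m) : x .e1 * P ^ m = P ^ m * x .e1 :=
    Commute.pow_right (by simp only [Commute, SemiconjBy, mul_assoc, aL, hx.gR]) m
  have hQ (m) : x .e1 * Q ^ m = Q ^ m * x .e1 :=
    Commute.pow_right (by simp only [Commute, SemiconjBy, mul_assoc, bL, hx.aR]) m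
  have hS (m) : x .e2 * S ^ m = S ^ m * x .e2 :=
    Commute.pow_right (by simp only [Commute, SemiconjBy, mul_assoc, gL, hx.bR]) m
  have hP' (m z) : x .e1 * (P ^ m * z) = P ^ m * (x .e1 * z) := by
    rw [← mul_assoc, hP, mul_assoc]
  have hQ' (m z) : x .e1 * (Q ^ m * z) = Q ^ m * (x .e1 * z) := by
    rw [← mul_assoc, hQ, mul_assoc]
  have hS' (m z) : x .e2 * (S ^ m * z) = S ^ m * (x .e2 * z) := by
    rw [← mul_assoc, hS, mul_assoc]
  have e1e1 (z) : x .e1 * (x .e1 * z) = x .e1 * z := by rw [← mul_assoc, hx.idem1]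
  have e2e2 (z) : x .e2 * (x .e2 * z) = x .e2 * z := by rw [← mul_assoc, hx.idem2]
  have e12 {y z} (hy : y * x .e1 = y) (hz : x .e2 * z = z) : y * z = 0 := by
    rw [← hy, ← hz, mul_assoc, ← mul_assoc (x .e1), hx.orth12, zero_mul, mul_zero]
  have e21 {y z} (hy : y * x .e2 = y) (hz : x .e1 * z = z) : y * z = 0 := by
    rw [← hy, ← hz, mul_assoc, ← mul_assoc (x .e2), hx.orth21, zero_mul, mul_zero]
  have ha (m z) : x .a * (Q ^ m * z) = P ^ m * (x .a * z) := by
    rw [← mul_assoc, a_mul_pow, mul_assoc]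
  have hb (m z) : x .b * (S ^ m * z) = Q ^ m * (x .b * z) := by
    rw [← mul_assoc, b_mul_pow, mul_assoc]
  have hg (m z) : x .g * (P ^ m * z) = S ^ m * (x .g * z) := by
    rw [← mul_assoc, g_mul_pow, mul_assoc]
  have aP {m} (hm : m ≠ 0) : x .a * P ^ m = 0 :=
    mul_pow_eq_zero (by simp only [← mul_assoc, hx.aab hk ht, zero_mul]) hm
  have gQ {m} (hm : m ≠ 0) : x .g * Q ^ m = 0 :=
    mul_pow_eq_zero (by simp only [← mul_assoc, hx.gbga hk ht]) hm
  have hS0 {m} (hm : m ≠ 0) : x .h * S ^ m = 0 :=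
    mul_pow_eq_zero (by simp only [← mul_assoc, hx.hga hk ht, zero_mul]) hm
  cases s <;> apply model_hom_ext hk <;> intro m <;>
  simp [hk, ht, apply_ite (Finsupp.linearCombination F (path k t x)),
    hx.linearCombination_vec_a hk ht,
    hx.linearCombination_vec_g hk ht, hx.linearCombination_vec_ga hk ht,
    hx.linearCombination_vec_b hk ht, hx.linearCombination_vec_bg hk ht,
    hx.linearCombination_vec_ab hk ht, hx.linearCombination_vec_bga hk ht,
    hx.linearCombination_vecABG hk ht, hx.linearCombination_vecH hk ht,
    hx.linearCombination_vec_gab hk ht]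
  case e1.ga | e1.g | e1.gab | e1.h | a.ga | a.g | a.gab | a.h | g.ga | g.g | g.gab | g.h =>
    exact (e12 (by simp [hx.idem1, hx.aR, hx.gR])
      (by simp only [e2e2, hS', gL, hx.gL])).symm
  case e2.a | e2.bg | e2.b | e2.ab | e2.bga | e2.abg | b.a | b.bg | b.b | b.ab | b.bga | b.abg |
      h.a | h.bg | h.b | h.ab | h.bga | h.abg =>
    exact (e21 (by simp [hx.idem2, hx.bR, hx.hR])
      (by simp only [e1e1, hP', hQ', aL, bL, hx.aL, hx.bL])).symm
  case e1.a | e1.bg | e1.b | e1.ab | e1.bga | e1.abg =>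
    simp only [e1e1, hP', hQ', aL, bL, hx.aL, hx.bL]
  case e2.ga | e2.g | e2.gab | e2.h =>
    simp only [e2e2, hS', gL, hx.gL]
  case a.a =>
    split_ifs with hm
    · rw [hm, pow_zero, one_mul, hx.asq, hx.P_eq_Q hk, ← Nat.sub_add_cancel hk,
        hx.e1_mul_Q_pow_succ]
    · rw [← mul_assoc, aP hm, zero_mul]
  case a.bg => rw [ha, hx.e1_mul_P_pow_succ, pow_succ, mul_assoc (x .a)]
  case a.b => rw [ha]
  case a.ab =>
    by_cases hm : m = 0
    · rw [hm, pow_zero, one_mul, ← mul_assoc, hx.aab hk ht]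
    · rw [← mul_assoc, aP hm, zero_mul]
  case a.bga => rw [← mul_assoc, hx.aR, a_mul_pow]
  case a.abg => rw [← mul_assoc, hx.aR, aP m.succ_ne_zero]
  case b.ga => rw [hb, hx.e1_mul_Q_pow_succ, pow_succ, mul_assoc (x .b)]
  case b.g => rw [hb]
  case b.gab => rw [← mul_assoc, hx.bR, b_mul_pow]
  case b.h =>
    rw [← mul_assoc (x .b) (x .e2), hx.bR]
    split_ifs with hm
    · rw [hm, zero_add, pow_one, hx.bh]
    · rw [hx.b_mul_h_pow (by omega)]
  case g.a => rw [hg]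
  case g.bg =>
    by_cases hm : m = 0
    · rw [hm, pow_zero, one_mul, ← mul_assoc (x .g) (x .b), hx.gb]
      obtain rfl | ht' := ht.eq_or_lt
      · simp [hx.hg]
      · rw [hx.h_pow_mul_g (by omega), if_neg (by omega)]
    · rw [← mul_assoc (x .g), gQ hm, if_neg (by simp [hm]), zero_mul]
  case g.b =>
    split_ifs with hm
    · rw [hm, pow_zero, one_mul, hx.gb, show t - 1 = t - 2 + 1 by omega, hx.e2_mul_h_pow_succ]
    · rw [← mul_assoc, gQ hm, zero_mul]
  case g.ab => rw [hg, hx.e2_mul_S_pow_succ, pow_succ, mul_assoc (x .g)]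
  case g.bga =>
    rw [← mul_assoc, hx.gR]
    split_ifs with hm
    · rw [hm, pow_zero, mul_one]
    · rw [gQ hm]
  case g.abg => rw [← mul_assoc, hx.gR, g_mul_pow]
  case h.ga =>
    by_cases hm : m = 0
    · rw [hm, pow_zero, one_mul, ← mul_assoc, hx.hga hk ht]
    · rw [← mul_assoc, hS0 hm, zero_mul]
  case h.g =>
    split_ifs with hm
    · rw [hm, pow_zero, one_mul, hx.hg]
    · rw [← mul_assoc, hS0 hm, zero_mul]
  case h.gab =>
    rw [← mul_assoc, hx.hR]
    split_ifs with hm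
    · rw [hm, pow_zero, mul_one, hx.hL]
    · rw [hS0 hm]
  case h.h => rw [← mul_assoc, hx.hR, hx.e2_mul_h_pow_succ, pow_succ']

end Rels

end Paths

section Basis

variable {F} {k t c}

theorem span_range_path (hk : 1 ≤ k) (ht : 2 ≤ t) :
    Submodule.span F (Set.range (path k t (genBA k t c))) = ⊤ := by
  have hx := rels_genBA k t c
  rw [← Finsupp.range_linearCombination]
  refine submodule_eq_top_of_genBA_mul_mem _ ⟨vec F .bga 0 + vec F .gab 0, ?_⟩ ?_
  · rw [map_add, hx.linearCombination_vec_bga hk ht, hx.linearCombination_vec_gab hk ht, pow_zero,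
      pow_zero, mul_one, mul_one, hx.unit]
  · rintro s _ ⟨v, rfl⟩
    exact ⟨op k t c s v, hx.linearCombination_op hk ht s v⟩

theorem path_op_apply (hk : 1 ≤ k) (ht : 2 ≤ t) (i : Idx k t) :
    path k t (op k t c) i (vec F .bga 0 + vec F .gab 0) = Finsupp.single i 1 := by
  cases i with
  | a i => simp [path, P_pow_a, single_eq_vec]
  | ga i => simp [path, S_pow_ga, single_eq_vec]
  | g i => simp [path, S_pow_g hk, single_eq_vec]
  | bg i => simp [path, Q_pow_bg hk, single_eq_vec]
  | b i => simp [path, Q_pow_b, single_eq_vec]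
  | ab i => simp [path, P_pow_ab, single_eq_vec]
  | bga i =>
    rw [single_eq_vec]
    by_cases hi : (i : ℕ) = 0
    · simp [path, hi]
    · simp [path, Q_pow_bga, pow_apply_eq_zero (Nat.one_le_iff_ne_zero.2 hi)]
  | gab i =>
    rw [single_eq_vec]
    by_cases hi : (i : ℕ) = 0
    · simp [path, hi]
    · simp [path, S_pow_gab, pow_apply_eq_zero (Nat.one_le_iff_ne_zero.2 hi)]
  | abg i =>
    have h := P_pow_abg hk (c := c) (t := t) (i + 1) 0
    rw [vecABG_zero, zero_add, vecABG, if_neg (by omega), if_neg (by omega), Nat.add_sub_cancel,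
      ← single_eq_vec] at h
    rw [path, map_add, h, pow_apply_eq_zero (by omega) (by simp), add_zero]
  | h i =>
    have h := h_pow_h hk ht (c := c) (i + 1) 0
    rw [vecH_zero, zero_add, vecH, if_neg (by omega), if_neg (by omega), Nat.add_sub_cancel,
      ← single_eq_vec] at h
    rw [path, map_add, h, pow_apply_eq_zero (by omega) (by simp), zero_add]

theorem map_path {R R' : Type} [Ring R] [Ring R'] (f : R →+* R') (x : Gen → R)
    (i : Idx k t) : f (path k t x i) = path k t (fun s => f (x s)) i := by
  cases i <;> simp [path]

theorem linearIndependent_path (hk : 1 ≤ k) (ht : 2 ≤ t) :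
    LinearIndependent F (path k t (genBA k t c)) := by
  obtain ⟨f, hf⟩ := (rels_op (c := c) hk ht).exists_algHom
  refine LinearIndependent.of_comp
    (LinearMap.applyₗ (vec F .bga 0 + vec F .gab 0) ∘ₗ f.toLinearMap) ?_
  convert (Finsupp.basisSingleOne (R := F) (ι := Idx k t)).linearIndependent using 1
  ext1 i
  refine Eq.trans ?_ (path_op_apply (c := c) hk ht i)
  have h := map_path f.toRingHom (genBA k t c) i
  simp only [AlgHom.toRingHom_eq_coe, RingHom.coe_coe, hf] at h
  simp [h]

section

variable (F k t c)

theorem path_genBA_a (i : Fin k) :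
    path k t (genBA k t c) (.a i) = ABG F k t c ^ (i : ℕ) * Al F k t c := rfl

theorem path_genBA_ga (i : Fin k) :
    path k t (genBA k t c) (.ga i) = GAB F k t c ^ (i : ℕ) * (Ga F k t c * Al F k t c) := rfl

theorem path_genBA_g (i : Fin k) :
    path k t (genBA k t c) (.g i) = GAB F k t c ^ (i : ℕ) * Ga F k t c := rfl

theorem path_genBA_bg (i : Fin k) :
    path k t (genBA k t c) (.bg i) = BGA F k t c ^ (i : ℕ) * (Be F k t c * Ga F k t c) := rfl

theorem path_genBA_b (i : Fin k) :
    path k t (genBA k t c) (.b i) = BGA F k t c ^ (i : ℕ) * Be F k t c := rfl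

theorem path_genBA_ab (i : Fin k) :
    path k t (genBA k t c) (.ab i) = ABG F k t c ^ (i : ℕ) * (Al F k t c * Be F k t c) := rfl

theorem path_genBA_bga (i : Fin (k + 1)) :
    path k t (genBA k t c) (.bga i) = E1 F k t c * BGA F k t c ^ (i : ℕ) := rfl

theorem path_genBA_gab (i : Fin (k + 1)) :
    path k t (genBA k t c) (.gab i) = E2 F k t c * GAB F k t c ^ (i : ℕ) := rfl

theorem path_genBA_abg (i : Fin (k - 1)) :
    path k t (genBA k t c) (.abg i) = ABG F k t c ^ ((i : ℕ) + 1) := rfl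

theorem path_genBA_h (i : Fin (t - 1)) :
    path k t (genBA k t c) (.h i) = Et F k t c ^ ((i : ℕ) + 1) := rfl

theorem E1_mul_BGA_pow {m : ℕ} (hm : 1 ≤ m) :
    E1 F k t c * BGA F k t c ^ m = BGA F k t c ^ m := by
  obtain ⟨m, rfl⟩ := Nat.exists_eq_add_of_le' hm
  exact (rels_genBA k t c).e1_mul_Q_pow_succ m

theorem E2_mul_GAB_pow {m : ℕ} (hm : 1 ≤ m) :
    E2 F k t c * GAB F k t c ^ m = GAB F k t c ^ m := by
  obtain ⟨m, rfl⟩ := Nat.exists_eq_add_of_le' hm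
  exact (rels_genBA k t c).e2_mul_S_pow_succ m

theorem ABG_pow_eq_BGA_pow (hk : 1 ≤ k) : ABG F k t c ^ k = BGA F k t c ^ k :=
  (rels_genBA k t c).P_eq_Q hk

theorem Et_pow_eq_GAB_pow (hk : 1 ≤ k) (ht : 2 ≤ t) : Et F k t c ^ t = GAB F k t c ^ k :=
  (rels_genBA k t c).h_pow_eq_S hk ht

end

theorem path_mem_BB (hk : 1 ≤ k) (ht : 2 ≤ t) (i : Idx k t) :
    path k t (genBA k t c) i ∈ BB F k t c := by
  have mem (i : Fin k) (hi : ¬ (i : ℕ) = 0) : (i : ℕ) ∈ Set.Icc 1 (k - 1) := by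
    rw [Set.mem_Icc]
    omega
  cases i with
  | a i =>
    rw [path_genBA_a]
    by_cases hi : (i : ℕ) = 0
    · rw [hi, pow_zero, one_mul]
      exact .inl (.inl (.inl (.inl (.inl (.inl (.inl (.inr (.inl rfl))))))))
    · exact .inl (.inl (.inl (.inl (.inl (.inr ⟨i, mem i hi, rfl⟩)))))
  | ga i =>
    rw [path_genBA_ga]
    by_cases hi : (i : ℕ) = 0
    · rw [hi, pow_zero, one_mul]
      exact .inl (.inr (.inl (.inl (.inr rfl))))
    · exact .inl (.inr (.inr ⟨i, mem i hi, rfl⟩))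
  | g i =>
    rw [path_genBA_g]
    by_cases hi : (i : ℕ) = 0
    · rw [hi, pow_zero, one_mul]
      exact .inl (.inr (.inl (.inl (.inl rfl))))
    · exact .inl (.inr (.inl (.inr ⟨i, mem i hi, rfl⟩)))
  | bg i =>
    rw [path_genBA_bg]
    by_cases hi : (i : ℕ) = 0
    · rw [hi, pow_zero, one_mul]
      exact .inl (.inl (.inl (.inl (.inl (.inl (.inl (.inr (.inr (.inl rfl)))))))))
    · exact .inl (.inl (.inl (.inr ⟨i, mem i hi, rfl⟩)))
  | b i =>
    rw [path_genBA_b]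
    by_cases hi : (i : ℕ) = 0
    · rw [hi, pow_zero, one_mul]
      exact .inl (.inl (.inr (.inl (.inl (.inl rfl)))))
    · exact .inl (.inl (.inr (.inl (.inr ⟨i, mem i hi, rfl⟩))))
  | ab i =>
    rw [path_genBA_ab]
    by_cases hi : (i : ℕ) = 0
    · rw [hi, pow_zero, one_mul]
      exact .inl (.inl (.inr (.inl (.inl (.inr rfl)))))
    · exact .inl (.inl (.inr (.inr ⟨i, mem i hi, rfl⟩)))
  | bga i =>
    rw [path_genBA_bga]
    by_cases hi : (i : ℕ) = 0
    · rw [hi, pow_zero, mul_one]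
      exact .inl (.inl (.inl (.inl (.inl (.inl (.inl (.inl rfl)))))))
    · rw [E1_mul_BGA_pow F k t c (by omega)]
      by_cases hi' : (i : ℕ) = k
      · rw [hi', ← ABG_pow_eq_BGA_pow F k t c hk]
        exact .inl (.inl (.inl (.inl (.inl (.inl (.inl (.inr (.inr (.inr rfl)))))))))
      · exact .inl (.inl (.inl (.inl (.inr ⟨i, mem ⟨i, by omega⟩ hi, rfl⟩))))
  | gab i =>
    rw [path_genBA_gab]
    by_cases hi : (i : ℕ) = 0
    · rw [hi, pow_zero, mul_one]
      exact .inr (.inl (.inl rfl))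
    · rw [E2_mul_GAB_pow F k t c (by omega)]
      by_cases hi' : (i : ℕ) = k
      · rw [hi', ← Et_pow_eq_GAB_pow F k t c hk ht]
        exact .inr (.inr ⟨t, ⟨by omega, le_rfl⟩, rfl⟩)
      · exact .inr (.inl (.inr ⟨i, mem ⟨i, by omega⟩ hi, rfl⟩))
  | abg i => exact .inl (.inl (.inl (.inl (.inl (.inl (.inr ⟨i + 1, ⟨by omega, by omega⟩, rfl⟩))))))
  | h i => exact .inr (.inr ⟨i + 1, ⟨by omega, by omega⟩, rfl⟩)

theorem BB_subset_range_path (hk : 1 ≤ k) (ht : 2 ≤ t) :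
    BB F k t c ⊆ Set.range (path k t (genBA k t c)) := by
  rintro y (((hy | hy) | hy) | hy)
  · obtain ((((rfl | rfl | rfl | rfl) | ⟨i, hi, rfl⟩) | ⟨i, hi, rfl⟩) | ⟨i, hi, rfl⟩) |
      ⟨i, hi, rfl⟩ := hy
    · exact ⟨.bga 0, by rw [path_genBA_bga, Fin.val_zero, pow_zero, mul_one]⟩
    · exact ⟨.a ⟨0, hk⟩, by rw [path_genBA_a, pow_zero, one_mul]⟩
    · exact ⟨.bg ⟨0, hk⟩, by rw [path_genBA_bg, pow_zero, one_mul]⟩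
    · exact ⟨.bga (Fin.last k), by
        rw [path_genBA_bga, Fin.val_last, E1_mul_BGA_pow F k t c hk,
          ABG_pow_eq_BGA_pow F k t c hk]⟩
    · rw [Set.mem_Icc] at hi
      exact ⟨.abg ⟨i - 1, by omega⟩, by rw [path_genBA_abg, Nat.sub_add_cancel hi.1]⟩
    · exact ⟨.a ⟨i, by grind⟩, rfl⟩
    · exact ⟨.bga ⟨i, by grind⟩, E1_mul_BGA_pow F k t c hi.1⟩
    · exact ⟨.bg ⟨i, by grind⟩, rfl⟩
  · obtain ((rfl | rfl) | ⟨i, hi, rfl⟩) | ⟨i, hi, rfl⟩ := hy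
    · exact ⟨.b ⟨0, hk⟩, by rw [path_genBA_b, pow_zero, one_mul]⟩
    · exact ⟨.ab ⟨0, hk⟩, by rw [path_genBA_ab, pow_zero, one_mul]⟩
    · exact ⟨.b ⟨i, by grind⟩, rfl⟩
    · exact ⟨.ab ⟨i, by grind⟩, rfl⟩
  · obtain ((rfl | rfl) | ⟨i, hi, rfl⟩) | ⟨i, hi, rfl⟩ := hy
    · exact ⟨.g ⟨0, hk⟩, by rw [path_genBA_g, pow_zero, one_mul]⟩
    · exact ⟨.ga ⟨0, hk⟩, by rw [path_genBA_ga, pow_zero, one_mul]⟩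
    · exact ⟨.g ⟨i, by grind⟩, rfl⟩
    · exact ⟨.ga ⟨i, by grind⟩, rfl⟩
  · obtain (rfl | ⟨i, hi, rfl⟩) | ⟨i, hi, rfl⟩ := hy
    · exact ⟨.gab 0, by rw [path_genBA_gab, Fin.val_zero, pow_zero, mul_one]⟩
    · exact ⟨.gab ⟨i, by grind⟩, E2_mul_GAB_pow F k t c hi.1⟩
    · rw [Set.mem_Icc] at hi
      dsimp only
      by_cases hi' : i = t
      · exact ⟨.gab (Fin.last k), by
          rw [path_genBA_gab, Fin.val_last, E2_mul_GAB_pow F k t c hk, hi',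
            Et_pow_eq_GAB_pow F k t c hk ht]⟩
      · exact ⟨.h ⟨i - 1, by omega⟩, by rw [path_genBA_h, Nat.sub_add_cancel hi.1]⟩

end Basis

/-- **Basis of `B^{k,t}_c` (semidihedral type, second family).**  For `k ≥ 1`,
`t ≥ 2` with `k + t ≥ 4` and `c ∈ {0,1}` the set 𝓑 is an F-basis of `B^{k,t}_c`;
in particular `dim_F B^{k,t}_c = 9k + t`.  Moreover `(αβγ)^k = (βγα)^k = βηγ`,
`η^{t-1} = γβ` and `η^t = (γαβ)^k = ηγβ`. -/
theorem semidihedral_two_standard_basis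
    (F : Type) [Field F] [IsAlgClosed F] [CharP F 2]
    (k t : ℕ) (hk : 1 ≤ k) (ht : 2 ≤ t) (hkt : 4 ≤ k + t) (c : F) (hc : c = 0 ∨ c = 1) :
    LinearIndependent F (fun p : (BB F k t c) => (p : BA F k t c)) ∧
    Submodule.span F (BB F k t c) = ⊤ ∧
    Module.finrank F (BA F k t c) = 9 * k + t ∧
    (ABG F k t c) ^ k = (BGA F k t c) ^ k ∧
    (BGA F k t c) ^ k = Be F k t c * Et F k t c * Ga F k t c ∧
    (Et F k t c) ^ (t - 1) = Ga F k t c * Be F k t c ∧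
    (Et F k t c) ^ t = (GAB F k t c) ^ k ∧
    (GAB F k t c) ^ k = Et F k t c * Ga F k t c * Be F k t c := by
  have hx := rels_genBA k t c
  have h1 := linearIndependent_path (c := c) hk ht
  have h2 := span_range_path (c := c) hk ht
  have hfin : Module.finrank F (BA F k t c) = 9 * k + t := by
    rw [Module.finrank_eq_card_basis (Module.Basis.mk h1 h2.ge), Idx.card k t hk ht]
  rw [← (Set.range_subset_iff.2 (path_mem_BB hk ht)).antisymm (BB_subset_range_path hk ht)]
  exact ⟨h1.linearIndepOn_id, h2, hfin, hx.P_eq_Q hk, (hx.bhg_eq_Q hk).symm, hx.gb.symm,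
    hx.h_pow_eq_S hk ht, hx.S_eq_hgb hk⟩

end SD2Paper

end
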